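/- arXiv:2504.08315 — 2 statements merged into one kernel-verified Lean document; each statement's English description precedes it below -/
import Mathlib

section
/- For every x ∈ ℝ with 0 ≤ x ≤ 1, the binary entropy function satisfies the lower bound (1 - x) * log(1 - x) + x * log(x) ≥ 2 * (x - 1/2)^2 + log(1/2), with the convention 0 * log 0 = 0 (Mathlib's log 0 = 0). -/
open Real

lemma concaveOn_binEntropy_add_quadratic :
    ConcaveOn ℝ (Set.Icc 0 1) fun p : ℝ ↦ binEntropy p + 2 * (p - 1 / 2) ^ 2 := by
  refine concaveOn_of_hasDerivWithinAt2_nonpos (convex_Icc 0 1)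
    (f' := fun p ↦ log (1 - p) - log p + 4 * (p - 1 / 2))
    (f'' := fun p ↦ -1 / (1 - p) - p⁻¹ + 4) (by fun_prop) ?_ ?_ ?_ <;>
    rw [interior_Icc] <;> rintro p ⟨hp0, hp1⟩
  · have h := (hasDerivAt_binEntropy hp0.ne' hp1.ne).add
      ((((hasDerivAt_id p).sub_const (1 / 2)).pow 2).const_mul 2)
    refine (h.congr_deriv ?_).hasDerivWithinAt
    simp only [id]
    ring
  · have h := ((((hasDerivAt_id p).const_sub 1).log (sub_pos.2 hp1).ne').sub
      (hasDerivAt_log hp0.ne')).add (((hasDerivAt_id p).sub_const (1 / 2)).const_mul 4)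
    refine (h.congr_deriv ?_).hasDerivWithinAt
    simp only [id]
    ring
  · have hq : 0 < 1 - p := sub_pos.2 hp1
    have h : -1 / (1 - p) - p⁻¹ + 4 = -((2 * p - 1) ^ 2 / (p * (1 - p))) := by
      field_simp
      ring
    rw [h, neg_nonpos]
    positivity

/-- **Quadratic lower bound for the binary entropy.**
For `0 ≤ x ≤ 1`, `(1 - x) log (1 - x) + x log x ≥ 2 (x - 1/2)^2 + log (1/2)`
(with the convention `0 * log 0 = 0`, valid since `Real.log 0 = 0`). -/
theorem binary_entropy_quadratic_lower_bound
    (x : ℝ) (hx0 : 0 ≤ x) (hx1 : x ≤ 1) :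
    (1 - x) * Real.log (1 - x) + x * Real.log x ≥
      2 * (x - 1 / 2) ^ 2 + Real.log (1 / 2) := by
  have hx : x ∈ Set.Icc (0 : ℝ) 1 := ⟨hx0, hx1⟩
  have hy : 1 - x ∈ Set.Icc (0 : ℝ) 1 := ⟨sub_nonneg.2 hx1, sub_le_self 1 hx0⟩
  have h := concaveOn_binEntropy_add_quadratic.2 hx hy
    (one_half_pos (α := ℝ)).le (one_half_pos (α := ℝ)).le (add_halves 1)
  have hmid : (1 / 2 : ℝ) * x + 1 / 2 * (1 - x) = 2⁻¹ := by ring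
  simp only [smul_eq_mul, hmid, binEntropy_one_sub, binEntropy_two_inv] at h
  simp only [binEntropy, log_inv] at h
  rw [one_div, log_inv]
  linarith
end

section
/- Let G be a simple graph on a finite vertex type V, and for s : V → ℝ taking values in {0,1} define the Maximum Independent Set QUBO objective H(s) = -Σ_{v} s v + 2 * Σ_{e ∈ edges of G} s(e.1) * s(e.2) (each edge counted once). Let α be the independence number of G (the maximum cardinality of an independent set of vertices). Then: (i) for every s taking values in {0,1}, H(s) ≥ -α; (ii) H(s) = -α if and only if the set {v | s v = 1} is an independent set of G of cardinality α. -/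
open Finset Real

/-- A set of vertices is independent if no two of its vertices are adjacent.
(Matches the later Mathlib definition `SimpleGraph.IsIndepSet`.) -/
def SimpleGraph.IsIndepSet' {V : Type*} (G : SimpleGraph V) (S : Set V) : Prop :=
  S.Pairwise fun u v => ¬G.Adj u v

/-- Deleting one endpoint of each edge inside `T` leaves an independent set. -/
theorem SimpleGraph.exists_isIndepSet'_card_le_add {V : Type*} [Fintype V] [DecidableEq V]
    (G : SimpleGraph V) [DecidableRel G.Adj] (T : Finset V) :
    ∃ I : Finset V, G.IsIndepSet' ↑I ∧
      T.card ≤ I.card + (G.edgeFinset.filter (· ∈ T.sym2)).card := by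
  set F := G.edgeFinset.filter (· ∈ T.sym2) with hF
  refine ⟨T \ F.image fun e => e.out.1, ?_, ?_⟩
  · intro u hu v hv _ huv
    simp only [coe_sdiff, Set.mem_sdiff, mem_coe, mem_image, not_exists, not_and] at hu hv
    have he : s(u, v) ∈ F := by
      simp [hF, huv, hu.1, hv.1]
    rcases Sym2.mem_iff.1 (Sym2.out_fst_mem s(u, v)) with h | h
    · exact hu.2 _ he h
    · exact hv.2 _ he h
  · have h₁ := le_card_sdiff (F.image fun e => e.out.1) T
    have h₂ : (F.image fun e => e.out.1).card ≤ F.card := card_image_le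
    omega

theorem SimpleGraph.isIndepSet'_iff_filter_sym2_eq_empty {V : Type*} [Fintype V] [DecidableEq V]
    (G : SimpleGraph V) [DecidableRel G.Adj] (T : Finset V) :
    G.IsIndepSet' ↑T ↔ G.edgeFinset.filter (· ∈ T.sym2) = ∅ := by
  rw [filter_eq_empty_iff]
  constructor
  · intro h e
    induction e with
    | _ u v =>
      intro he hT
      rw [mem_edgeFinset, mem_edgeSet] at he
      rw [mk_mem_sym2_iff] at hT
      exact h hT.1 hT.2 he.ne he
  · intro h u hu v hv _ huv
    exact h (x := s(u, v)) (by simpa using huv) (mk_mem_sym2_iff.2 ⟨hu, hv⟩)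

theorem sum_eq_card_filter_eq_one {V : Type*} [Fintype V] (s : V → ℝ)
    [DecidablePred fun v => s v = 1] (hs : ∀ v, s v = 0 ∨ s v = 1) :
    ∑ v, s v = ((univ.filter fun v => s v = 1).card : ℝ) := by
  rw [card_filter, Nat.cast_sum]
  refine sum_congr rfl fun v _ => ?_
  rcases hs v with h | h <;> simp [h]

theorem SimpleGraph.sum_edgeFinset_mul_eq_card {V : Type*} [Fintype V] [DecidableEq V]
    (G : SimpleGraph V) [DecidableRel G.Adj] (s : V → ℝ)
    [DecidablePred fun v => s v = 1] (hs : ∀ v, s v = 0 ∨ s v = 1) :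
    ∑ e ∈ G.edgeFinset,
        Sym2.lift ⟨fun u v => s u * s v, fun u v => mul_comm (s u) (s v)⟩ e =
      ((G.edgeFinset.filter (· ∈ (univ.filter fun v => s v = 1).sym2)).card : ℝ) := by
  rw [card_filter, Nat.cast_sum]
  refine sum_congr rfl fun e _ => ?_
  induction e with
  | _ u v => rcases hs u with h | h <;> rcases hs v with h' | h' <;> simp [h, h']

/-- **MISP QUBO encoding.**
The QUBO objective `H s = -∑ v, s v + 2 * ∑ e ∈ E(G), s e.1 * s e.2` over binary
configurations is bounded below by minus the independence number `α`, with
equality iff `{v | s v = 1}` is an independent set of cardinality `α`. -/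
theorem misp_qubo_encoding
    {V : Type*} [Fintype V] [DecidableEq V]
    (G : SimpleGraph V) [DecidableRel G.Adj]
    (H : (V → ℝ) → ℝ)
    (hH : ∀ s, H s = -(∑ v, s v) +
        2 * ∑ e ∈ G.edgeFinset,
          Sym2.lift ⟨fun u v => s u * s v, fun u v => mul_comm (s u) (s v)⟩ e)
    (α : ℕ)
    (hα₁ : ∃ S : Finset V, G.IsIndepSet' ↑S ∧ S.card = α)
    (hα₂ : ∀ S : Finset V, G.IsIndepSet' ↑S → S.card ≤ α) :
    (∀ s : V → ℝ, (∀ v, s v = 0 ∨ s v = 1) → H s ≥ -(α : ℝ)) ∧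
    (∀ s : V → ℝ, (∀ v, s v = 0 ∨ s v = 1) →
      (H s = -(α : ℝ) ↔
        G.IsIndepSet' {v | s v = 1} ∧ Set.ncard {v | s v = 1} = α)) := by
  classical
  have key : ∀ s : V → ℝ, (∀ v, s v = 0 ∨ s v = 1) → ∃ T : Finset V, ∃ m : ℕ,
      (T : Set V) = {v | s v = 1} ∧ H s = -(T.card : ℝ) + 2 * m ∧ T.card ≤ α + m ∧
        (G.IsIndepSet' ↑T ↔ m = 0) := by
    intro s hs
    obtain ⟨I, hI, hcard⟩ := G.exists_isIndepSet'_card_le_add (univ.filter fun v => s v = 1)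
    refine ⟨univ.filter fun v => s v = 1, _, by simp, ?_,
      hcard.trans (Nat.add_le_add_right (hα₂ I hI) _), ?_⟩
    · rw [hH, sum_eq_card_filter_eq_one s hs, G.sum_edgeFinset_mul_eq_card s hs]
    · rw [G.isIndepSet'_iff_filter_sym2_eq_empty, card_eq_zero]
  refine ⟨fun s hs => ?_, fun s hs => ?_⟩
  · obtain ⟨T, m, -, hHs, hle, -⟩ := key s hs
    have hle' : (T.card : ℝ) ≤ α + m := mod_cast hle
    have hm : (0 : ℝ) ≤ m := m.cast_nonneg
    linarith
  · obtain ⟨T, m, hT, hHs, hle, hind⟩ := key s hs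
    rw [← hT, Set.ncard_coe_finset, hind, hHs]
    constructor
    · intro h
      have h' : T.card = α + 2 * m := by
        have : (T.card : ℝ) = α + 2 * m := by linarith
        exact_mod_cast this
      omega
    · rintro ⟨rfl, h⟩
      simp [h]
end
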